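/- Let n ≥ 2 and h > 0, and let u be the solution of u''/(1+(u')²) = −(1+nu)/u² with u(0) = h, u'(0) = 0, u > 0, defined on its maximal interval of existence I. Then I = (−T, T) with T = ∫₀^h ((h/s)^{2n} e^{2/s − 2/h} − 1)^{−1/2} ds < ∞, u is even (u(−t) = u(t)), u is strictly concave, u(t) → 0 as t → ±T, and u'(t) → ∓∞ as t → ±T. -/

import Mathlib

open Set Filter Topology intervalIntegral

/-- The grim-reaper ODE written for the graph `x₀ = u(x₁)`:
`u''/(1+(u')²) = −(1+nu)/u²` at `t`. -/
def GrimODE' (n : ℕ) (u : ℝ → ℝ) (t : ℝ) : Prop :=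
  deriv (deriv u) t / (1 + (deriv u t) ^ 2) = -(1 + (n : ℝ) * u t) / (u t) ^ 2

/-- The logarithm of `(h / s) ^ (2 * n) * exp (2 / s - 2 / h)`, which equals `1 + (u')²` at height
`s` along the solution of height `h`. -/
noncomputable def grimEnergy (n : ℕ) (h s : ℝ) : ℝ :=
  2 * n * (Real.log h - Real.log s) + 2 / s - 2 / h

/-- The absolute value of the slope at height `s` of the solution of height `h`. -/
noncomputable def grimSlope (n : ℕ) (h s : ℝ) : ℝ :=
  Real.sqrt (Real.exp (grimEnergy n h s) - 1)

/-- The time the solution of height `h` needs to descend from its maximum to height `x`. -/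
noncomputable def grimTime (n : ℕ) (h x : ℝ) : ℝ :=
  ∫ s in x..h, (grimSlope n h s)⁻¹

/-- A positive `C²` solution of the grim-reaper ODE on the open interval `(a, b)`. -/
def IsGrimSol (n : ℕ) (a b : EReal) (v : ℝ → ℝ) : Prop :=
  ∀ t : ℝ, a < (t : EReal) → (t : EReal) < b → ContDiffAt ℝ 2 v t ∧ 0 < v t ∧ GrimODE' n v t

section Energy

variable {n : ℕ} {h s : ℝ}

lemma grimEnergy_self : grimEnergy n h h = 0 := by
  simp [grimEnergy]

lemma exp_grimEnergy (hh : 0 < h) (hs : 0 < s) :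
    Real.exp (grimEnergy n h s) = (h / s) ^ (2 * n) * Real.exp (2 / s - 2 / h) := by
  have hpow : (h / s) ^ (2 * n) = Real.exp (2 * n * (Real.log h - Real.log s)) := by
    rw [← Real.log_div hh.ne' hs.ne', ← Real.exp_log (pow_pos (div_pos hh hs) (2 * n)),
      Real.log_pow]
    push_cast
    rfl
  rw [hpow, ← Real.exp_add, grimEnergy]
  ring_nf

lemma hasDerivAt_grimEnergy (hs : s ≠ 0) :
    HasDerivAt (grimEnergy n h) (-(2 * (1 + n * s) / s ^ 2)) s := by
  have h1 := ((Real.hasDerivAt_log hs).const_sub (Real.log h)).const_mul (2 * (n : ℝ))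
  have h2 := (hasDerivAt_inv hs).const_mul 2
  have h3 := (h1.add h2).sub_const (2 / h)
  refine (h3.congr_deriv ?_).congr_of_eventuallyEq (.of_forall fun x => ?_)
  · field_simp
    ring
  · simp [grimEnergy, div_eq_mul_inv]

lemma two_div_sub_le_grimEnergy (hs : 0 < s) (hsh : s ≤ h) :
    2 / s - 2 / h ≤ grimEnergy n h s := by
  have := Real.log_le_log hs hsh
  have : 0 ≤ 2 * (n : ℝ) * (Real.log h - Real.log s) := by
    have := sub_nonneg.2 this
    positivity
  unfold grimEnergy
  linarith

lemma grimEnergy_pos (hs : 0 < s) (hsh : s < h) : 0 < grimEnergy n h s := by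
  have h1 : 2 / h < 2 / s := by gcongr
  linarith [two_div_sub_le_grimEnergy (n := n) hs hsh.le]

lemma exp_grimEnergy_sub_one_pos (hs : 0 < s) (hsh : s < h) :
    0 < Real.exp (grimEnergy n h s) - 1 :=
  sub_pos.2 (Real.one_lt_exp_iff.2 (grimEnergy_pos hs hsh))

lemma grimSlope_pos (hs : 0 < s) (hsh : s < h) : 0 < grimSlope n h s :=
  Real.sqrt_pos.2 (exp_grimEnergy_sub_one_pos hs hsh)

lemma contDiffAt_grimSlope {k : WithTop ℕ∞} (hs : 0 < s) (hsh : s < h) :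
    ContDiffAt ℝ k (grimSlope n h) s := by
  have hE : ContDiffAt ℝ k (grimEnergy n h) s := by
    unfold grimEnergy
    have h1 : ContDiffAt ℝ k Real.log s := Real.contDiffAt_log.2 hs.ne'
    have h2 : ContDiffAt ℝ k (fun s : ℝ => 2 / s) s := contDiffAt_const.div contDiffAt_id hs.ne'
    exact ((contDiffAt_const.mul (contDiffAt_const.sub h1)).add h2).sub contDiffAt_const
  exact (hE.exp.sub contDiffAt_const).sqrt (exp_grimEnergy_sub_one_pos hs hsh).ne'

lemma hasDerivAt_grimSlope (hs : 0 < s) (hsh : s < h) :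
    HasDerivAt (grimSlope n h)
      (-((1 + grimSlope n h s ^ 2) * ((1 + n * s) / s ^ 2)) / grimSlope n h s) s := by
  have hp := exp_grimEnergy_sub_one_pos (n := n) hs hsh
  refine ((((hasDerivAt_grimEnergy hs.ne').exp).sub_const 1).sqrt hp.ne').congr_deriv ?_
  have hsq : grimSlope n h s ^ 2 = Real.exp (grimEnergy n h s) - 1 := Real.sq_sqrt hp.le
  have := (grimSlope_pos (n := n) hs hsh).ne'
  change _ / (2 * grimSlope n h s) = _
  rw [hsq]
  field_simp
  ring

lemma tendsto_grimSlope_zero (hh : 0 < h) :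
    Tendsto (grimSlope n h) (𝓝[>] 0) atTop := by
  refine Real.tendsto_sqrt_atTop.comp ?_
  refine tendsto_atTop_add_const_right _ _ (Real.tendsto_exp_atTop.comp ?_)
  have h1 : Tendsto (fun s : ℝ => 2 * s⁻¹ - 2 / h) (𝓝[>] 0) atTop :=
    tendsto_atTop_add_const_right _ _ (tendsto_inv_nhdsGT_zero.const_mul_atTop two_pos)
  refine tendsto_atTop_mono' _ ?_ h1
  filter_upwards [Ioo_mem_nhdsGT hh] with s hs
  simpa [div_eq_mul_inv] using two_div_sub_le_grimEnergy (n := n) hs.1 hs.2.le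

lemma intervalIntegrable_inv_grimSlope (hh : 0 < h) :
    IntervalIntegrable (fun s => (grimSlope n h s)⁻¹) MeasureTheory.volume 0 h := by
  have h0 : IntervalIntegrable (fun x : ℝ => x ^ (-(1 / 2) : ℝ)) MeasureTheory.volume h 0 :=
    intervalIntegrable_rpow' (by norm_num)
  have h1 := (h0.comp_sub_left h).const_mul h
  rw [sub_self, sub_zero] at h1
  refine h1.mono_fun ?_ ?_
  · refine Measurable.aestronglyMeasurable ?_
    unfold grimSlope grimEnergy
    fun_prop
  · have hae : ∀ᵐ s ∂MeasureTheory.volume, s ≠ h := by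
      simp [MeasureTheory.ae_iff]
    filter_upwards [MeasureTheory.ae_restrict_of_ae hae,
      MeasureTheory.ae_restrict_mem measurableSet_uIoc] with s hne hs
    rw [uIoc_of_le hh.le] at hs
    have hs0 := hs.1
    have hsh : s < h := lt_of_le_of_ne hs.2 hne
    have hd : 0 < h - s := sub_pos.2 hsh
    have hlow : (h - s) / h ^ 2 ≤ Real.exp (grimEnergy n h s) - 1 := by
      have e1 := Real.add_one_le_exp (grimEnergy n h s)
      have e2 := two_div_sub_le_grimEnergy (n := n) hs0 hsh.le
      have e3 : (h - s) / h ^ 2 ≤ 2 / s - 2 / h := by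
        rw [div_sub_div _ _ hs0.ne' hh.ne', div_le_div_iff₀ (by positivity) (by positivity)]
        nlinarith [mul_pos hd hh, mul_pos (mul_pos hd hh) hd]
      linarith
    have hsl : Real.sqrt (h - s) / h ≤ grimSlope n h s := by
      have := Real.sqrt_le_sqrt hlow
      rwa [Real.sqrt_div' _ (by positivity), Real.sqrt_sq hh.le] at this
    have hp := Real.sqrt_pos.2 hd
    rw [Real.norm_of_nonneg (inv_nonneg.2 (grimSlope_pos hs0 hsh).le),
      Real.norm_of_nonneg (by positivity), Real.rpow_neg hd.le, ← Real.sqrt_eq_rpow]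
    calc (grimSlope n h s)⁻¹ ≤ (Real.sqrt (h - s) / h)⁻¹ := by gcongr
      _ = h * (Real.sqrt (h - s))⁻¹ := by rw [inv_div, div_eq_mul_inv]

end Energy

section Time

variable {n : ℕ} {h : ℝ}

lemma grimTime_self : grimTime n h h = 0 := integral_same

lemma continuousOn_grimTime (hh : 0 < h) : ContinuousOn (grimTime n h) (Icc 0 h) := by
  rw [← uIcc_of_le hh.le]
  refine continuousOn_primitive_interval_left ?_
  rw [uIcc_of_le hh.le]
  exact (intervalIntegrable_iff_integrableOn_Icc_of_le hh.le).1
    (intervalIntegrable_inv_grimSlope hh)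

lemma hasDerivAt_grimTime {x : ℝ} (hx : 0 < x) (hxh : x < h) :
    HasDerivAt (grimTime n h) (-(grimSlope n h x)⁻¹) x := by
  have hc : ∀ y ∈ Ioo 0 h, ContinuousAt (fun s => (grimSlope n h s)⁻¹) y := fun y hy =>
    ((contDiffAt_grimSlope (k := 0) hy.1 hy.2).continuousAt).inv₀ (grimSlope_pos hy.1 hy.2).ne'
  refine integral_hasDerivAt_left ?_ ?_ (hc x ⟨hx, hxh⟩)
  · refine (intervalIntegrable_inv_grimSlope (hx.trans hxh)).mono_set ?_
    rw [uIcc_of_le hxh.le, uIcc_of_le (hx.trans hxh).le]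
    exact Icc_subset_Icc_left hx.le
  · exact ContinuousAt.stronglyMeasurableAtFilter isOpen_Ioo hc x ⟨hx, hxh⟩

lemma strictAntiOn_grimTime (hh : 0 < h) : StrictAntiOn (grimTime n h) (Icc 0 h) := by
  refine strictAntiOn_of_deriv_neg (convex_Icc 0 h) (continuousOn_grimTime hh) fun x hx => ?_
  rw [interior_Icc] at hx
  rw [(hasDerivAt_grimTime hx.1 hx.2).deriv]
  exact neg_neg_of_pos (inv_pos.2 (grimSlope_pos hx.1 hx.2))

lemma grimTime_zero_pos (hh : 0 < h) : 0 < grimTime n h 0 := by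
  have := strictAntiOn_grimTime (n := n) hh ⟨le_rfl, hh.le⟩ ⟨hh.le, le_rfl⟩ hh
  rwa [grimTime_self] at this

lemma grimTime_zero_eq (hh : 0 < h) : grimTime n h 0 = ∫ s in (0 : ℝ)..h,
    (Real.sqrt ((h / s) ^ (2 * n) * Real.exp (2 / s - 2 / h) - 1))⁻¹ := by
  refine integral_congr_ae (.of_forall fun s hs => ?_)
  rw [uIoc_of_le hh.le] at hs
  rw [grimSlope, exp_grimEnergy hh hs.1]

/-- The inverse of `grimTime n h` on the open time interval is a solution of the ODE. -/
lemma exists_inverse_grimTime (hh : 0 < h) :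
    ∃ ψ : ℝ → ℝ, IsGrimSol n 0 (grimTime n h 0 : ℝ) ψ ∧
      ∀ t ∈ Ioo 0 (grimTime n h 0), ψ t ∈ Ioo 0 h ∧ grimTime n h (ψ t) = t := by
  set T := grimTime n h 0 with hT
  have hanti := strictAntiOn_grimTime (n := n) hh
  have hex : ∀ t : ℝ, ∃ x, t ∈ Ioo 0 T → x ∈ Ioo 0 h ∧ grimTime n h x = t := by
    intro t
    by_cases ht : t ∈ Ioo 0 T
    · have := intermediate_value_Ioo' hh.le (continuousOn_grimTime (n := n) hh)
      rw [grimTime_self] at this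
      obtain ⟨x, hx, hxt⟩ := this ht
      exact ⟨x, fun _ => ⟨hx, hxt⟩⟩
    · exact ⟨0, fun h => absurd h ht⟩
  choose ψ hψ using hex
  have hmem : ∀ x ∈ Ioo 0 h, grimTime n h x ∈ Ioo 0 T := fun x hx => by
    have h1 := hanti ⟨hx.1.le, hx.2.le⟩ ⟨hh.le, le_rfl⟩ hx.2
    rw [grimTime_self] at h1
    exact ⟨h1, hanti ⟨le_rfl, hh.le⟩ ⟨hx.1.le, hx.2.le⟩ hx.1⟩
  have hψanti : StrictMonoOn (fun t => -ψ t) (Ioo 0 T) := by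
    intro s hs t ht hst
    have h1 := hψ s hs
    have h2 := hψ t ht
    refine neg_lt_neg ?_
    rw [← hanti.lt_iff_gt (Ioo_subset_Icc_self h1.1) (Ioo_subset_Icc_self h2.1), h1.2, h2.2]
    exact hst
  have hcont : ∀ t ∈ Ioo 0 T, ContinuousAt ψ t := by
    intro t ht
    have : ContinuousAt (fun t => -ψ t) t := by
      refine hψanti.continuousAt_of_image_mem_nhds (Ioo_mem_nhds ht.1 ht.2) ?_
      have hpre := (hψ t ht).1
      refine mem_of_superset (Ioo_mem_nhds (neg_lt_neg hpre.2) (neg_lt_neg hpre.1)) ?_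
      intro y hy
      have hy' : -y ∈ Ioo 0 h := ⟨by linarith [hy.2], by linarith [hy.1]⟩
      refine ⟨grimTime n h (-y), hmem _ hy', ?_⟩
      have h3 := hψ _ (hmem _ hy')
      have := hanti.injOn (Ioo_subset_Icc_self h3.1) (Ioo_subset_Icc_self hy') h3.2
      simp [this]
    exact this.neg.congr (.of_forall fun s => neg_neg (ψ s))
  have hderiv : ∀ t ∈ Ioo 0 T, HasDerivAt ψ (-grimSlope n h (ψ t)) t := by
    intro t ht
    have hx := (hψ t ht).1
    have hne := (grimSlope_pos (n := n) hx.1 hx.2).ne'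
    refine ((hasDerivAt_grimTime (n := n) hx.1 hx.2).of_local_left_inverse (hcont t ht)
      (by simpa using hne) ?_).congr_deriv (by simp [inv_neg])
    filter_upwards [Ioo_mem_nhds ht.1 ht.2] with y hy using (hψ y hy).2
  have hderiv' : EqOn (deriv ψ) (fun t => -grimSlope n h (ψ t)) (Ioo 0 T) :=
    fun t ht => (hderiv t ht).deriv
  have hsmooth : ∀ k : ℕ, ContDiffOn ℝ k ψ (Ioo 0 T) := by
    intro k
    induction k with
    | zero =>
      exact contDiffOn_zero.2 fun t ht => (hcont t ht).continuousWithinAt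
    | succ k ih =>
      push_cast
      refine (contDiffOn_succ_iff_deriv_of_isOpen isOpen_Ioo).2
        ⟨fun t ht => (hderiv t ht).differentiableAt.differentiableWithinAt, by simp, ?_⟩
      refine ContDiffOn.congr (fun t ht => ?_) hderiv'
      exact (((contDiffAt_grimSlope (hψ t ht).1.1 (hψ t ht).1.2).comp_contDiffWithinAt t
        (ih t ht)).neg)
  refine ⟨ψ, fun t ht0 htT => ?_, fun t ht => hψ t ht⟩
  have ht : t ∈ Ioo 0 T := ⟨by exact_mod_cast ht0, by exact_mod_cast htT⟩
  have hx := (hψ t ht).1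
  refine ⟨(hsmooth 2).contDiffAt (Ioo_mem_nhds ht.1 ht.2), hx.1, ?_⟩
  have hev : deriv ψ =ᶠ[𝓝 t] fun t => -grimSlope n h (ψ t) :=
    hderiv'.eventuallyEq_of_mem (Ioo_mem_nhds ht.1 ht.2)
  have h2 := (((hasDerivAt_grimSlope (n := n) hx.1 hx.2).comp t (hderiv t ht)).neg)
  have h2' : deriv (deriv ψ) t = _ := hev.deriv_eq.trans h2.deriv
  rw [GrimODE', h2', hderiv' ht]
  have hne := (grimSlope_pos (n := n) hx.1 hx.2).ne'
  have hx0 := hx.1.ne'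
  have : (1 + grimSlope n h (ψ t) ^ 2) ≠ 0 := by positivity
  simp only [even_two, Even.neg_pow]
  field_simp

end Time

namespace IsGrimSol

variable {n : ℕ} {h : ℝ} {a b : EReal} {u : ℝ → ℝ} {t : ℝ}

lemma hasDerivAt (hu : IsGrimSol n a b u) (ha : a < (t : EReal)) (hb : (t : EReal) < b) :
    HasDerivAt u (deriv u t) t :=
  ((hu t ha hb).1.differentiableAt two_ne_zero).hasDerivAt

lemma hasDerivAt_deriv (hu : IsGrimSol n a b u) (ha : a < (t : EReal)) (hb : (t : EReal) < b) :
    HasDerivAt (deriv u) (-((1 + deriv u t ^ 2) * ((1 + n * u t) / u t ^ 2))) t := by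
  obtain ⟨hc, hpos, hode⟩ := hu t ha hb
  have hd : DifferentiableAt ℝ (deriv u) t :=
    (hc.derivWithin (m := 1) (by norm_num)).differentiableAt one_ne_zero
  refine hd.hasDerivAt.congr_deriv ?_
  have h1 : (1 + deriv u t ^ 2) ≠ 0 := by positivity
  rw [GrimODE', div_eq_iff h1] at hode
  rw [hode]
  ring

lemma deriv_deriv_neg (hu : IsGrimSol n a b u) (ha : a < (t : EReal)) (hb : (t : EReal) < b) :
    deriv (deriv u) t < 0 := by
  rw [(hu.hasDerivAt_deriv ha hb).deriv]
  have := (hu t ha hb).2.1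
  exact neg_neg_of_pos (by positivity)

lemma comp_neg (hu : IsGrimSol n a b u) : IsGrimSol n (-b) (-a) (fun t => u (-t)) := by
  intro t ht1 ht2
  have h1 : a < ((-t : ℝ) : EReal) := by rw [EReal.coe_neg]; exact EReal.lt_neg_comm.1 ht2
  have h2 : ((-t : ℝ) : EReal) < b := by rw [EReal.coe_neg]; exact EReal.neg_lt_comm.1 ht1
  obtain ⟨hc, hpos, hode⟩ := hu (-t) h1 h2
  refine ⟨hc.comp t contDiff_neg.contDiffAt, hpos, ?_⟩
  have hd : deriv (fun t => u (-t)) = fun t => -deriv u (-t) := funext (deriv_comp_neg u)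
  rw [GrimODE'] at hode ⊢
  rw [hd]
  simp only [deriv.fun_neg, deriv_comp_neg (deriv u), neg_neg, even_two, Even.neg_pow]
  exact hode

lemma deriv_neg_of_pos (hu : IsGrimSol n a b u) (ha : a < 0) (hinit' : deriv u 0 = 0)
    (ht0 : 0 < t) (htb : (t : EReal) < b) :
    deriv u t < 0 := by
  have hin : ∀ s ∈ Icc 0 t, a < (s : EReal) ∧ (s : EReal) < b := fun s hs =>
    ⟨ha.trans_le (by exact_mod_cast hs.1), lt_of_le_of_lt (by exact_mod_cast hs.2) htb⟩
  have := strictAntiOn_of_deriv_neg (convex_Icc 0 t) (f := deriv u)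
    (fun s hs => (hu.hasDerivAt_deriv (hin s hs).1 (hin s hs).2).continuousAt.continuousWithinAt)
    (fun s hs => hu.deriv_deriv_neg (hin s (interior_subset hs)).1 (hin s (interior_subset hs)).2)
    ⟨le_rfl, ht0.le⟩ ⟨ht0.le, le_rfl⟩ ht0
  rwa [hinit'] at this

lemma lt_height (hu : IsGrimSol n a b u) (ha : a < 0) (hinit : u 0 = h)
    (hinit' : deriv u 0 = 0)
    (ht0 : 0 < t) (htb : (t : EReal) < b) :
    u t < h := by
  have hin : ∀ s ∈ Icc 0 t, a < (s : EReal) ∧ (s : EReal) < b := fun s hs =>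
    ⟨ha.trans_le (by exact_mod_cast hs.1), lt_of_le_of_lt (by exact_mod_cast hs.2) htb⟩
  have := strictAntiOn_of_deriv_neg (convex_Icc 0 t) (f := u)
    (fun s hs => (hu.hasDerivAt (hin s hs).1 (hin s hs).2).continuousAt.continuousWithinAt)
    (fun s hs => by
      rw [interior_Icc] at hs
      exact hu.deriv_neg_of_pos ha hinit' hs.1 (hin s (Ioo_subset_Icc_self hs)).2)
    ⟨le_rfl, ht0.le⟩ ⟨ht0.le, le_rfl⟩ ht0
  rwa [hinit] at this

lemma deriv_eq_neg_grimSlope (hu : IsGrimSol n a b u) (ha : a < 0) (hinit : u 0 = h)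
    (hinit' : deriv u 0 = 0)
    (ht0 : 0 < t) (htb : (t : EReal) < b) :
    deriv u t = -grimSlope n h (u t) := by
  have hin : ∀ s ∈ Icc 0 t, a < (s : EReal) ∧ (s : EReal) < b := fun s hs =>
    ⟨ha.trans_le (by exact_mod_cast hs.1), lt_of_le_of_lt (by exact_mod_cast hs.2) htb⟩
  have hder : ∀ s ∈ Icc 0 t,
      HasDerivAt (fun s => Real.log (1 + deriv u s ^ 2) - grimEnergy n h (u s)) 0 s := by
    intro s hs
    obtain ⟨has, hsb⟩ := hin s hs
    have hpos := (hu s has hsb).2.1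
    have h1 : (1 + deriv u s ^ 2) ≠ 0 := by positivity
    have e1 := (((hu.hasDerivAt_deriv has hsb).pow 2).const_add 1).log h1
    have e2 := (hasDerivAt_grimEnergy (n := n) (h := h) hpos.ne').comp s (hu.hasDerivAt has hsb)
    refine (e1.sub e2).congr_deriv ?_
    simp only [Pi.pow_apply] at h1 ⊢
    field_simp
    ring
  obtain ⟨c, hc, hslope⟩ := exists_hasDerivAt_eq_slope _ _ ht0
    (fun s hs => (hder s hs).continuousAt.continuousWithinAt)
    (fun s hs => hder s (Ioo_subset_Icc_self hs))
  have hlog : Real.log (1 + deriv u t ^ 2) = grimEnergy n h (u t) := by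
    rw [eq_div_iff (by linarith), hinit', hinit, grimEnergy_self] at hslope
    norm_num at hslope
    linarith
  have hneg := hu.deriv_neg_of_pos ha hinit' ht0 htb
  rw [grimSlope, ← hlog, Real.exp_log (by positivity), add_sub_cancel_left,
    Real.sqrt_sq_eq_abs, abs_of_neg hneg, neg_neg]

lemma grimTime_eq (hu : IsGrimSol n a b u) (ha : a < 0) (hinit : u 0 = h)
    (hinit' : deriv u 0 = 0)
    (ht0 : 0 < t) (htb : (t : EReal) < b) (hh : 0 < h) :
    grimTime n h (u t) = t := by
  have hin : ∀ s ∈ Icc 0 t, a < (s : EReal) ∧ (s : EReal) < b := fun s hs =>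
    ⟨ha.trans_le (by exact_mod_cast hs.1), lt_of_le_of_lt (by exact_mod_cast hs.2) htb⟩
  have hmaps : MapsTo u (Icc 0 t) (Icc 0 h) := by
    intro s hs
    refine ⟨(hu s (hin s hs).1 (hin s hs).2).2.1.le, ?_⟩
    rcases hs.1.eq_or_lt with rfl | h0
    · exact hinit.le
    · exact (hu.lt_height ha hinit hinit' h0 (hin s hs).2).le
  have hder : ∀ s ∈ Ioo 0 t, HasDerivAt (fun s => grimTime n h (u s) - s) 0 s := by
    intro s hs
    obtain ⟨has, hsb⟩ := hin s (Ioo_subset_Icc_self hs)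
    have hpos := (hu s has hsb).2.1
    have hlt := hu.lt_height ha hinit hinit' hs.1 hsb
    refine (((hasDerivAt_grimTime (n := n) hpos hlt).comp s (hu.hasDerivAt has hsb)).sub
      (hasDerivAt_id s)).congr_deriv ?_
    rw [hu.deriv_eq_neg_grimSlope ha hinit hinit' hs.1 hsb, neg_mul_neg,
      inv_mul_cancel₀ (grimSlope_pos hpos hlt).ne', sub_self]
  have hcont : ContinuousOn (fun s => grimTime n h (u s) - s) (Icc 0 t) :=
    ((continuousOn_grimTime hh).comp (fun s hs =>
      (hu.hasDerivAt (hin s hs).1 (hin s hs).2).continuousAt.continuousWithinAt) hmaps).sub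
      continuousOn_id
  obtain ⟨c, hc, hslope⟩ := exists_hasDerivAt_eq_slope _ _ ht0 hcont hder
  rw [eq_div_iff (by linarith), hinit, grimTime_self] at hslope
  linarith

lemma lt_grimTime_zero (hu : IsGrimSol n a b u) (ha : a < 0) (hinit : u 0 = h)
    (hinit' : deriv u 0 = 0)
    (ht0 : 0 < t) (htb : (t : EReal) < b) (hh : 0 < h) :
    t < grimTime n h 0 := by
  have hpos := (hu t (ha.trans (by exact_mod_cast ht0)) htb).2.1
  have hlt := hu.lt_height ha hinit hinit' ht0 htb
  have := strictAntiOn_grimTime (n := n) hh ⟨le_rfl, hh.le⟩ ⟨hpos.le, hlt.le⟩ hpos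
  rwa [hu.grimTime_eq ha hinit hinit' ht0 htb hh] at this

lemma le_grimTime_zero (hu : IsGrimSol n a b u) (ha : a < 0) (hinit : u 0 = h)
    (hinit' : deriv u 0 = 0) (hh : 0 < h) : b ≤ (grimTime n h 0 : ℝ) := by
  by_contra! hlt
  exact (hu.lt_grimTime_zero ha hinit hinit' (grimTime_zero_pos hh) hlt hh).false

/-- A solution extends to the right up to the time `grimTime n h 0`. -/
lemma exists_extension (hu : IsGrimSol n a b u) (ha : a < 0) (hb : 0 < b) (hinit : u 0 = h)
    (hinit' : deriv u 0 = 0) (hh : 0 < h) :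
    ∃ v : ℝ → ℝ, (∀ t : ℝ, a < (t : EReal) → (t : EReal) < b → v t = u t) ∧
      IsGrimSol n a (grimTime n h 0 : ℝ) v := by
  obtain ⟨ψ, hψ, hψinv⟩ := exists_inverse_grimTime (n := n) hh
  have hψu : ∀ t : ℝ, 0 < t → (t : EReal) < b → ψ t = u t := by
    intro t h0 htb
    have hpos := (hu t (ha.trans (by exact_mod_cast h0)) htb).2.1
    have hlt := hu.lt_height ha hinit hinit' h0 htb
    obtain ⟨h1, h2⟩ := hψinv t ⟨h0, hu.lt_grimTime_zero ha hinit hinit' h0 htb hh⟩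
    exact (strictAntiOn_grimTime (n := n) hh).injOn (Ioo_subset_Icc_self h1) ⟨hpos.le, hlt.le⟩
      (h2.trans (hu.grimTime_eq ha hinit hinit' h0 htb hh).symm)
  let v : ℝ → ℝ := fun t => if t ≤ 0 then u t else ψ t
  have hvu : ∀ t : ℝ, (t : EReal) < b → v t = u t := by
    intro t htb
    by_cases h0 : t ≤ 0
    · simp [v, h0]
    · simpa [v, h0] using hψu t (not_le.1 h0) htb
  have hcongr : ∀ (w : ℝ → ℝ) (t : ℝ), v =ᶠ[𝓝 t] w →
      ContDiffAt ℝ 2 w t ∧ 0 < w t ∧ GrimODE' n w t →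
      ContDiffAt ℝ 2 v t ∧ 0 < v t ∧ GrimODE' n v t := by
    rintro w t hvw ⟨hc, hpos, hode⟩
    refine ⟨hc.congr_of_eventuallyEq hvw, hvw.eq_of_nhds ▸ hpos, ?_⟩
    rwa [GrimODE', hvw.deriv.deriv_eq, hvw.deriv_eq, hvw.eq_of_nhds]
  refine ⟨v, fun t _ htb => hvu t htb, fun t hat htT => ?_⟩
  rcases le_or_gt t 0 with h0 | h0
  · have htb : (t : EReal) < b := lt_of_le_of_lt (by exact_mod_cast h0) hb
    refine hcongr u t ?_ (hu t hat htb)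
    filter_upwards [continuous_coe_real_ereal.continuousAt.eventually_lt_const htb] with s hs
      using hvu s hs
  · refine hcongr ψ t ?_ (hψ t (by exact_mod_cast h0) htT)
    filter_upwards [Ioi_mem_nhds h0] with s hs
    simp [v, not_le.2 (mem_Ioi.1 hs)]

/-- Behaviour of a solution at the right end of its lifespan. -/
lemma tendsto_right {T : ℝ} (hu : IsGrimSol n a T u) (ha : a < 0) (hinit : u 0 = h)
    (hinit' : deriv u 0 = 0) (hh : 0 < h) (hT : T = grimTime n h 0) :
    Tendsto u (𝓝[<] T) (𝓝 0) ∧ Tendsto (deriv u) (𝓝[<] T) atBot := by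
  have hT0 : 0 < T := hT ▸ grimTime_zero_pos hh
  have hpos : ∀ᶠ t in 𝓝[<] T, 0 < u t := by
    filter_upwards [Ioo_mem_nhdsLT hT0] with t ht
    exact (hu t (ha.trans (by exact_mod_cast ht.1)) (by exact_mod_cast ht.2)).2.1
  have hlim : Tendsto u (𝓝[<] T) (𝓝 0) := by
    refine tendsto_order.2 ⟨fun c hc => hpos.mono fun t ht => hc.trans ht, fun c hc => ?_⟩
    have hanti := strictAntiOn_grimTime (n := n) hh
    have hm : 0 < min c h := lt_min hc hh
    have hmem : min c h ∈ Icc 0 h := ⟨hm.le, min_le_right _ _⟩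
    have hlt : grimTime n h (min c h) < T := hT ▸ hanti ⟨le_rfl, hh.le⟩ hmem hm
    filter_upwards [Ioo_mem_nhdsLT hT0, Ioo_mem_nhdsLT hlt, hpos] with t ht ht' hut
    have htT : (t : EReal) < (T : ℝ) := by exact_mod_cast ht.2
    have hle := hu.lt_height ha hinit hinit' ht.1 htT
    refine lt_of_lt_of_le ((hanti.lt_iff_gt hmem ⟨hut.le, hle.le⟩).1 ?_) (min_le_left c h)
    rw [hu.grimTime_eq ha hinit hinit' ht.1 htT hh]
    exact ht'.1
  refine ⟨hlim, ?_⟩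
  have hlim' : Tendsto u (𝓝[<] T) (𝓝[>] 0) := tendsto_nhdsWithin_iff.2 ⟨hlim, hpos⟩
  refine (tendsto_neg_atTop_atBot.comp ((tendsto_grimSlope_zero (n := n) hh).comp hlim')).congr' ?_
  filter_upwards [Ioo_mem_nhdsLT hT0] with t ht
  exact (hu.deriv_eq_neg_grimSlope ha hinit hinit' ht.1 (by exact_mod_cast ht.2)).symm

end IsGrimSol

/-- the maximal positive solution of `u''/(1+(u')²) = −(1+nu)/u²` with
`u(0)=h`, `u'(0)=0` is defined on `(−T,T)` with
`T = ∫₀ʰ ((h/s)^{2n} e^{2/s−2/h} − 1)^{−1/2} ds < ∞`; it is even, strictly concave,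
`u → 0` at `±T` and `u' → ∓∞` at `±T`. -/
theorem grim_reaper_height_graph (n : ℕ) (hn : 2 ≤ n) (h : ℝ) (hh : 0 < h)
    (a b : EReal) (ha : a < 0) (hb : (0 : EReal) < b)
    (u : ℝ → ℝ)
    (hreg : ∀ t : ℝ, a < (t : EReal) → (t : EReal) < b → ContDiffAt ℝ 2 u t)
    (hupos : ∀ t : ℝ, a < (t : EReal) → (t : EReal) < b → 0 < u t)
    (hode : ∀ t : ℝ, a < (t : EReal) → (t : EReal) < b → GrimODE' n u t)
    (hinit : u 0 = h) (hinit' : deriv u 0 = 0)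
    (hmax : ¬ ∃ (a' b' : EReal) (v : ℝ → ℝ), a' ≤ a ∧ b ≤ b' ∧ (a' < a ∨ b < b') ∧
        (∀ t : ℝ, a < (t : EReal) → (t : EReal) < b → v t = u t) ∧
        ∀ t : ℝ, a' < (t : EReal) → (t : EReal) < b' →
          ContDiffAt ℝ 2 v t ∧ 0 < v t ∧ GrimODE' n v t) :
    ∃ T : ℝ, 0 < T ∧
      T = ∫ s in (0 : ℝ)..h,
        (Real.sqrt ((h / s) ^ (2 * n) * Real.exp (2 / s - 2 / h) - 1))⁻¹ ∧
      a = ((-T : ℝ) : EReal) ∧ b = ((T : ℝ) : EReal) ∧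
      (∀ t ∈ Set.Ioo (-T) T, u (-t) = u t) ∧
      (∀ t ∈ Set.Ioo (-T) T, deriv (deriv u) t < 0) ∧
      Tendsto u (𝓝[<] T) (𝓝 0) ∧ Tendsto u (𝓝[>] (-T)) (𝓝 0) ∧
      Tendsto (deriv u) (𝓝[<] T) atBot ∧ Tendsto (deriv u) (𝓝[>] (-T)) atTop := by
  have hu : IsGrimSol n a b u := fun t h1 h2 => ⟨hreg t h1 h2, hupos t h1 h2, hode t h1 h2⟩
  have hw := hu.comp_neg
  set w : ℝ → ℝ := fun t => u (-t) with hwdef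
  have hwderiv : ∀ t, deriv w t = -deriv u (-t) := deriv_comp_neg u
  have ha' : 0 < -a := by simpa using EReal.neg_lt_neg_iff.2 ha
  have hb' : -b < 0 := by simpa using EReal.neg_lt_neg_iff.2 hb
  have hwinit : w 0 = h := by simpa [hwdef] using hinit
  have hwinit' : deriv w 0 = 0 := by simpa [hwderiv] using hinit'
  set T := grimTime n h 0 with hT
  have hbT : b = (T : ℝ) := by
    refine (hu.le_grimTime_zero ha hinit hinit' hh).antisymm ?_
    by_contra! hlt
    obtain ⟨v, hvu, hv⟩ := hu.exists_extension ha hb hinit hinit' hh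
    exact hmax ⟨a, (T : ℝ), v, le_rfl, hlt.le, .inr hlt, hvu, hv⟩
  have haT : -a = (T : ℝ) := by
    refine (hw.le_grimTime_zero hb' hwinit hwinit' hh).antisymm ?_
    by_contra! hlt
    obtain ⟨v, hvw, hv⟩ := hw.exists_extension hb' ha' hwinit hwinit' hh
    have hlt' : -((T : ℝ) : EReal) < a := EReal.neg_lt_comm.1 hlt
    refine hmax ⟨-(T : ℝ), b, fun t => v (-t), hlt'.le, le_rfl, .inl hlt', fun t h1 h2 => ?_, ?_⟩
    · have := hvw (-t) (by rw [EReal.coe_neg]; exact EReal.neg_lt_neg_iff.2 h2)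
        (by rw [EReal.coe_neg]; exact EReal.neg_lt_neg_iff.2 h1)
      simpa [hwdef] using this
    · have hv' := hv.comp_neg
      rwa [neg_neg] at hv'
  have haT' : a = ((-T : ℝ) : EReal) := by rw [EReal.coe_neg, ← haT, neg_neg]
  rw [haT] at hw
  have hu' := hu
  rw [hbT] at hu'
  obtain ⟨hlim, hdlim⟩ := hu'.tendsto_right ha hinit hinit' hh hT
  obtain ⟨hlimw, hdlimw⟩ := hw.tendsto_right hb' hwinit hwinit' hh hT
  have hneg : Tendsto (fun t : ℝ => -t) (𝓝[>] (-T)) (𝓝[<] T) := by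
    simpa using tendsto_neg_nhdsGT (a := -T)
  have heven : ∀ t : ℝ, 0 < t → t < T → u (-t) = u t := by
    intro t h0 htT
    have htT' : (t : EReal) < (T : ℝ) := by exact_mod_cast htT
    have h0' : (0 : EReal) < t := by exact_mod_cast h0
    exact (strictAntiOn_grimTime (n := n) hh).injOn
      ⟨(hw t (hb'.trans h0') htT').2.1.le, (hw.lt_height hb' hwinit hwinit' h0 htT').le⟩
      ⟨(hu' t (ha.trans h0') htT').2.1.le, (hu'.lt_height ha hinit hinit' h0 htT').le⟩
      ((hw.grimTime_eq hb' hwinit hwinit' h0 htT' hh).trans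
        (hu'.grimTime_eq ha hinit hinit' h0 htT' hh).symm)
  refine ⟨T, grimTime_zero_pos hh, grimTime_zero_eq hh, haT', hbT, fun t ht => ?_,
    fun t ht => ?_, hlim, ?_, hdlim, ?_⟩
  · rcases lt_trichotomy t 0 with h0 | rfl | h0
    · have := heven (-t) (neg_pos.2 h0) (by linarith [ht.1])
      rw [neg_neg] at this
      exact this.symm
    · rw [neg_zero]
    · exact heven t h0 ht.2
  · refine hu.deriv_deriv_neg ?_ ?_
    · rw [haT']
      exact_mod_cast ht.1
    · rw [hbT]
      exact_mod_cast ht.2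
  · simpa [hwdef, Function.comp_def] using hlimw.comp hneg
  · simpa [hwderiv, Function.comp_def] using tendsto_neg_atBot_atTop.comp (hdlimw.comp hneg)
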